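/- Let L be a finite distributive lattice with rank function r, and let α, β, γ, δ : L → ℝ≥0 satisfy α(x)β(y) ≤ γ(x∨y)δ(x∧y) for all x, y ∈ L. Then for every X, Y ⊆ L, the polynomial (∑_{z∈X∨Y} γ(z)q^{r(z)})(∑_{w∈X∧Y} δ(w)q^{r(w)}) − (∑_{x∈X} α(x)q^{r(x)})(∑_{y∈Y} β(y)q^{r(y)}) has all coefficients non-negative. -/

import Mathlib

open scoped FinsetFamily

open Polynomial

/-- The rank (height) of an element: the length of the longest chain having it
as maximal element. -/
noncomputable def latticeRank {L : Type*} [Preorder L] (a : L) : ℕ :=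
  sSup {k | ∃ c : Fin (k + 1) → L, StrictMono c ∧ c (Fin.last k) = a}

section Rank

variable {L : Type*} [DistribLattice L] [Fintype L]

open Classical in
/-- The join-irreducible elements below `a`. -/
noncomputable def supIrredBelow (a : L) : Finset L :=
  Finset.univ.filter fun p ↦ SupIrred p ∧ p ≤ a

lemma mem_supIrredBelow {a p : L} : p ∈ supIrredBelow a ↔ SupIrred p ∧ p ≤ a := by
  simp [supIrredBelow]

lemma supIrredBelow_mono : Monotone (supIrredBelow (L := L)) := fun _ _ hab _ hp ↦
  mem_supIrredBelow.2 ((mem_supIrredBelow.1 hp).imp_right (·.trans hab))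

lemma exists_supIrred_le_not_le {a b : L} (h : ¬ a ≤ b) : ∃ p, SupIrred p ∧ p ≤ a ∧ ¬ p ≤ b := by
  have : Nonempty L := ⟨a⟩
  let _ := Fintype.toOrderBot L
  obtain ⟨s, rfl, hs⟩ := exists_supIrred_decomposition a
  by_contra! H
  exact h <| Finset.sup_le fun p hp ↦ H p (hs hp) (Finset.le_sup (f := id) hp)

lemma supIrredBelow_strictMono : StrictMono (supIrredBelow (L := L)) := by
  intro b a hab
  obtain ⟨p, hp, hpa, hpb⟩ := exists_supIrred_le_not_le hab.not_ge
  refine (Finset.ssubset_iff_of_subset (supIrredBelow_mono hab.le)).2 ⟨p, ?_, ?_⟩ <;>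
    simp [mem_supIrredBelow, *]

lemma card_supIrredBelow_of_covBy {a b : L} (h : b ⋖ a) :
    (supIrredBelow a).card = (supIrredBelow b).card + 1 := by
  classical
  have hsub := supIrredBelow_mono h.le
  rw [← Finset.card_sdiff_add_card_eq_card hsub, add_comm, add_right_inj, Finset.card_eq_one]
  obtain ⟨p, hp, hpa, hpb⟩ := exists_supIrred_le_not_le h.lt.not_ge
  have key : ∀ q r : L, SupIrred q → q ≤ a → ¬ q ≤ b → r ≤ a → ¬ r ≤ b → q ≤ r := by
    intro q r hq hqa hqb hra hrb
    have : b ⊔ r = a := (h.eq_or_eq le_sup_left (sup_le h.le hra)).resolve_left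
      fun e ↦ hrb (e ▸ le_sup_right)
    exact (hq.supPrime.le_sup.1 (this ▸ hqa)).resolve_left hqb
  refine ⟨p, Finset.eq_singleton_iff_unique_mem.2 ⟨?_, fun q hq ↦ ?_⟩⟩
  · simp [mem_supIrredBelow, *]
  · simp only [Finset.mem_sdiff, mem_supIrredBelow, not_and] at hq
    obtain ⟨⟨hq, hqa⟩, hqb⟩ := hq
    exact (key q p hq hqa (hqb hq) hpa hpb).antisymm (key p q hp hpa hpb hqa (hqb hq))

lemma supIrredBelow_eq_empty {a : L} (ha : IsMin a) : supIrredBelow a = ∅ :=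
  Finset.eq_empty_of_forall_notMem fun _ hp ↦
    (mem_supIrredBelow.1 hp).1.1 (ha.mono (mem_supIrredBelow.1 hp).2)

lemma exists_ltSeries_length_eq_card (a : L) :
    ∃ c : LTSeries L, c.length = (supIrredBelow a).card ∧ c.last = a := by
  induction a using WellFoundedLT.induction with
  | ind a ih =>
    by_cases ha : IsMin a
    · exact ⟨RelSeries.singleton _ a, by simp [supIrredBelow_eq_empty ha], rfl⟩
    · obtain ⟨b, hb⟩ := exists_covBy_of_wellFoundedGT ha
      obtain ⟨c, hc, rfl⟩ := ih b hb.lt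
      exact ⟨c.snoc a hb.lt, by simp [hc, card_supIrredBelow_of_covBy hb], by simp⟩

/-- In a finite distributive lattice, the rank of `a` counts the join-irreducibles below `a`. -/
lemma latticeRank_eq_card (a : L) : latticeRank a = (supIrredBelow a).card := by
  refine IsGreatest.csSup_eq ⟨?_, ?_⟩
  · obtain ⟨c, hc, hca⟩ := exists_ltSeries_length_eq_card a
    rw [← hc]
    exact ⟨c, c.strictMono, hca⟩
  · rintro k ⟨c, hc, rfl⟩
    have (i : Fin (k + 1)) : (i : ℕ) ≤ (supIrredBelow (c i)).card := by
      induction i using Fin.induction with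
      | zero => simp
      | succ i ih =>
        have := Finset.card_lt_card (supIrredBelow_strictMono (hc i.castSucc_lt_succ))
        simp only [Fin.val_castSucc, Fin.val_succ] at ih ⊢
        omega
    simpa using this (Fin.last k)

lemma latticeRank_sup_add_inf (a b : L) :
    latticeRank (a ⊔ b) + latticeRank (a ⊓ b) = latticeRank a + latticeRank b := by
  classical
  simp only [latticeRank_eq_card]
  rw [← Finset.card_union_add_card_inter (supIrredBelow a)]
  congr 2
  · ext p
    simp only [Finset.mem_union, mem_supIrredBelow, ← and_or_left]
    exact and_congr_right fun hp ↦ hp.supPrime.le_sup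
  · ext p
    simp only [Finset.mem_inter, mem_supIrredBelow, le_inf_iff]
    tauto

end Rank

section FourFunctions

variable {L : Type*} [DistribLattice L]

lemma sup_sup_inf_eq {a b c d u v : L} (h₁ : a ⊔ b = u) (h₂ : a ⊓ b = v) (h₃ : c ⊔ d = u)
    (h₄ : c ⊓ d = v) : (a ⊔ c) ⊔ (b ⊓ d) = u ∧ (a ⊔ c) ⊓ (b ⊓ d) = v := by
  subst h₁ h₂
  constructor
  · apply le_antisymm
    · exact sup_le (sup_le le_sup_left (le_sup_left.trans h₃.le)) (inf_le_left.trans le_sup_right)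
    · rw [sup_inf_left]
      refine le_inf (sup_le_sup_right le_sup_left _) (h₃.ge.trans ?_)
      exact sup_le_sup_right le_sup_right _
  · apply le_antisymm
    · rw [inf_sup_right]
      refine sup_le (inf_le_inf_left _ inf_le_left) (le_trans ?_ h₄.le)
      exact inf_le_inf_left _ inf_le_right
    · refine le_inf (inf_le_left.trans le_sup_left) (le_inf inf_le_right ?_)
      exact h₄.ge.trans inf_le_right

variable [DecidableEq L]

/-- The pairs in `A ×ˢ B` with given join and meet. -/
def pairsWithSupInf (A B : Finset L) (u v : L) : Finset (L × L) :=
  (A ×ˢ B).filter fun p ↦ (p.1 ⊔ p.2, p.1 ⊓ p.2) = (u, v)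

lemma mem_pairsWithSupInf {A B : Finset L} {u v : L} {p : L × L} :
    p ∈ pairsWithSupInf A B u v ↔ (p.1 ∈ A ∧ p.2 ∈ B) ∧ p.1 ⊔ p.2 = u ∧ p.1 ⊓ p.2 = v := by
  simp [pairsWithSupInf]

lemma sum_pairsWithSupInf_swap (A B : Finset L) (u v : L) (f g : L → ℝ) :
    ∑ p ∈ pairsWithSupInf B A u v, g p.1 * f p.2 =
      ∑ p ∈ pairsWithSupInf A B u v, f p.1 * g p.2 := by
  refine Finset.sum_equiv (Equiv.prodComm L L) (fun p ↦ ?_) fun p _ ↦ mul_comm _ _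
  simp only [mem_pairsWithSupInf, Equiv.prodComm_apply, Prod.fst_swap, Prod.snd_swap,
    sup_comm p.2, inf_comm p.2]
  tauto

/-- The four functions theorem refined to pairs with prescribed join and meet. It is the four
functions theorem in `L × Lᵒᵈ`, whose pairs with prescribed join and meet form a sublattice. -/
lemma sum_pairsWithSupInf_le {α β γ δ : L → ℝ}
    (hα : ∀ x, 0 ≤ α x) (hβ : ∀ x, 0 ≤ β x) (hγ : ∀ x, 0 ≤ γ x) (hδ : ∀ x, 0 ≤ δ x)
    (h : ∀ x y : L, α x * β y ≤ γ (x ⊔ y) * δ (x ⊓ y)) (A B : Finset L) (u v : L) :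
    ∑ p ∈ pairsWithSupInf A B u v, α p.1 * β p.2 ≤
      ∑ p ∈ pairsWithSupInf (A ⊻ B) (A ⊼ B) u v, γ p.1 * δ p.2 := by
  have hS : 0 ≤ ∑ p ∈ pairsWithSupInf (A ⊻ B) (A ⊼ B) u v, γ p.1 * δ p.2 :=
    Finset.sum_nonneg fun p _ ↦ mul_nonneg (hγ _) (hδ _)
  refine abs_le_of_sq_le_sq' ?_ hS |>.2
  let e : L × L ≃ L × Lᵒᵈ := (Equiv.refl L).prodCongr OrderDual.toDual
  have key := four_functions_theorem (α := L × Lᵒᵈ)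
    (fun p ↦ α p.1 * β p.2.ofDual) (fun p ↦ β p.1 * α p.2.ofDual)
    (fun p ↦ δ p.1 * γ p.2.ofDual) (fun p ↦ γ p.1 * δ p.2.ofDual)
    (fun p ↦ mul_nonneg (hα _) (hβ _)) (fun p ↦ mul_nonneg (hβ _) (hα _))
    (fun p ↦ mul_nonneg (hδ _) (hγ _)) (fun p ↦ mul_nonneg (hγ _) (hδ _))
    (fun p q ↦ by
      have h₁ := h p.1 q.1
      have h₂ := h q.2.ofDual p.2.ofDual
      rw [sup_comm, inf_comm q.2.ofDual] at h₂
      have := mul_le_mul h₁ h₂ (mul_nonneg (hα _) (hβ _)) (mul_nonneg (hγ _) (hδ _))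
      simp only [Prod.fst_inf, Prod.fst_sup, Prod.snd_inf, Prod.snd_sup, ofDual_inf, ofDual_sup]
      linarith)
    ((pairsWithSupInf A B u v).map e.toEmbedding) ((pairsWithSupInf B A u v).map e.toEmbedding)
  have hsup : (pairsWithSupInf A B u v).map e.toEmbedding ⊻
      (pairsWithSupInf B A u v).map e.toEmbedding ⊆
      (pairsWithSupInf (A ⊻ B) (A ⊼ B) u v).map e.toEmbedding := by
    refine Finset.sups_subset_iff.2 fun a ha b hb ↦ ?_
    obtain ⟨⟨p₁, p₂⟩, hp, rfl⟩ := Finset.mem_map.1 ha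
    obtain ⟨⟨q₁, q₂⟩, hq, rfl⟩ := Finset.mem_map.1 hb
    obtain ⟨⟨hp₁, hp₂⟩, hpu, hpv⟩ := mem_pairsWithSupInf.1 hp
    obtain ⟨⟨hq₁, hq₂⟩, hqu, hqv⟩ := mem_pairsWithSupInf.1 hq
    refine Finset.mem_map.2 ⟨(p₁ ⊔ q₁, p₂ ⊓ q₂), mem_pairsWithSupInf.2
      ⟨⟨Finset.sup_mem_sups hp₁ hq₁, ?_⟩, sup_sup_inf_eq hpu hpv hqu hqv⟩, rfl⟩
    rw [inf_comm]
    exact Finset.inf_mem_infs hq₂ hp₂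
  have hinf : (pairsWithSupInf A B u v).map e.toEmbedding ⊼
      (pairsWithSupInf B A u v).map e.toEmbedding ⊆
      (pairsWithSupInf (A ⊼ B) (A ⊻ B) u v).map e.toEmbedding := by
    refine Finset.infs_subset_iff.2 fun a ha b hb ↦ ?_
    obtain ⟨⟨p₁, p₂⟩, hp, rfl⟩ := Finset.mem_map.1 ha
    obtain ⟨⟨q₁, q₂⟩, hq, rfl⟩ := Finset.mem_map.1 hb
    obtain ⟨⟨hp₁, hp₂⟩, hpu, hpv⟩ := mem_pairsWithSupInf.1 hp
    obtain ⟨⟨hq₁, hq₂⟩, hqu, hqv⟩ := mem_pairsWithSupInf.1 hq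
    simp only at hpu hpv hqu hqv
    rw [sup_comm] at hpu hqu
    rw [inf_comm] at hpv hqv
    have := sup_sup_inf_eq hpu hpv hqu hqv
    rw [sup_comm (p₂ ⊔ q₂), inf_comm (p₂ ⊔ q₂)] at this
    refine Finset.mem_map.2 ⟨(p₁ ⊓ q₁, p₂ ⊔ q₂), mem_pairsWithSupInf.2
      ⟨⟨Finset.inf_mem_infs hp₁ hq₁, ?_⟩, this⟩, rfl⟩
    rw [sup_comm]
    exact Finset.sup_mem_sups hq₂ hp₂
  have key' := key.trans (mul_le_mul
    (Finset.sum_le_sum_of_subset_of_nonneg hinf fun p _ _ ↦ mul_nonneg (hδ _) (hγ _))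
    (Finset.sum_le_sum_of_subset_of_nonneg hsup fun p _ _ ↦ mul_nonneg (hγ _) (hδ _))
    (Finset.sum_nonneg fun p _ ↦ mul_nonneg (hγ _) (hδ _))
    (Finset.sum_nonneg fun p _ ↦ mul_nonneg (hδ _) (hγ _)))
  simp only [Finset.sum_map, Equiv.coe_toEmbedding, e, Equiv.prodCongr_apply, Prod.map,
    Equiv.refl_apply, OrderDual.ofDual_toDual] at key'
  rwa [sum_pairsWithSupInf_swap A B u v α β, sum_pairsWithSupInf_swap (A ⊻ B) (A ⊼ B) u v γ δ,
    ← sq, ← sq] at key'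

variable [Fintype L]

/-- The coefficients of a product of two rank generating functions, grouped by join and meet. -/
lemma coeff_sum_mul_sum (A B : Finset L) (f g : L → ℝ) (k : ℕ) :
    ((∑ x ∈ A, C (f x) * X ^ latticeRank x) *
        (∑ y ∈ B, C (g y) * X ^ latticeRank y)).coeff k =
      ∑ w : L × L, if latticeRank w.1 + latticeRank w.2 = k then
        ∑ p ∈ pairsWithSupInf A B w.1 w.2, f p.1 * g p.2 else 0 := by
  have (x y : L) : (C (f x) * X ^ latticeRank x * (C (g y) * X ^ latticeRank y)).coeff k =
      if latticeRank x + latticeRank y = k then f x * g y else 0 := by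
    rw [mul_mul_mul_comm, ← C_mul, ← pow_add, coeff_C_mul_X_pow]
    simp only [eq_comm]
  rw [Finset.sum_mul_sum, ← Finset.sum_product', finsetSum_coeff,
    ← Finset.sum_fiberwise (A ×ˢ B) fun p ↦ (p.1 ⊔ p.2, p.1 ⊓ p.2)]
  refine Finset.sum_congr rfl fun w _ ↦ ?_
  rw [← Finset.sum_const_zero (s := pairsWithSupInf A B w.1 w.2), ← Finset.sum_ite_irrel]
  refine Finset.sum_congr rfl fun p hp ↦ ?_
  obtain ⟨-, hu, hv⟩ := mem_pairsWithSupInf.1 hp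
  rw [this, ← hu, ← hv, latticeRank_sup_add_inf]

end FourFunctions

/-- The q-analogue of the four functions theorem on a finite distributive
lattice, conjectured by Björner. -/
theorem q_four_functions_theorem_lattice (L : Type*) [DistribLattice L] [Fintype L]
    [DecidableEq L] (α β γ δ : L → ℝ)
    (hα : ∀ x, 0 ≤ α x) (hβ : ∀ x, 0 ≤ β x) (hγ : ∀ x, 0 ≤ γ x) (hδ : ∀ x, 0 ≤ δ x)
    (h : ∀ x y : L, α x * β y ≤ γ (x ⊔ y) * δ (x ⊓ y))
    (X' Y' : Finset L) :
    ∀ k : ℕ,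
      ((∑ x ∈ X', C (α x) * X ^ latticeRank x) *
        (∑ y ∈ Y', C (β y) * X ^ latticeRank y)).coeff k ≤
      ((∑ z ∈ X' ⊻ Y', C (γ z) * X ^ latticeRank z) *
        (∑ w ∈ X' ⊼ Y', C (δ w) * X ^ latticeRank w)).coeff k := by
  intro k
  rw [coeff_sum_mul_sum, coeff_sum_mul_sum]
  gcongr
  split_ifs
  · exact sum_pairsWithSupInf_le hα hβ hγ hδ h X' Y' _ _
  · exact le_rfl
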